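/- arXiv:2603.13564 — 6 statements merged into one kernel-verified Lean document; each statement's English description precedes it below -/
import Mathlib

section
/- Let B and D be unital C*-algebras, let q : B → D be a surjective ⋆-homomorphism, and let (i_λ)_{λ∈Λ} be a quasicentral approximate unit for the ideal I = ker q. Then for every x, y ∈ B and every positive integer N one has limsup_λ ‖[(x(1−i_λ))^N, y]‖ = ‖[q(x)^N, q(y)]‖. -/
open Filter

/-- A star homomorphism of C*-algebras realises its quotient norm: modulo its kernel, every element
has a representative of norm at most any prescribed positive `r ≥ ‖q b‖`. -/
theorem exists_map_eq_norm_le_of_norm_map_le {B D : Type*} [CStarAlgebra B] [CStarAlgebra D]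
    (q : B →⋆ₐ[ℂ] D) (b : B) {r : ℝ} (hr : 0 < r) (hb : ‖q b‖ ≤ r) :
    ∃ c : B, q c = q b ∧ ‖c‖ ≤ r := by
  let _ := CStarAlgebra.spectralOrder B
  have := CStarAlgebra.spectralOrderedRing B
  let f : ℝ → ℝ := fun t => r / max r (√t)
  have hpos : ∀ t : ℝ, 0 < max r (√t) := fun t => lt_max_of_lt_left hr
  have hf : Continuous f :=
    continuous_const.div (continuous_const.max Real.continuous_sqrt) fun t => (hpos t).ne'
  have hsa : IsSelfAdjoint (star b * b) := .star_mul_self b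
  refine ⟨b * cfc f (star b * b), ?_, ?_⟩
  · have hq : Continuous q := AddMonoidHomClass.continuous_of_bound q 1 fun z => by
      simpa using NonUnitalStarAlgHom.norm_apply_le q z
    have hmap : q (cfc f (star b * b)) = 1 := by
      rw [StarAlgHomClass.map_cfc q f (star b * b) hf.continuousOn
        hq hsa (hsa.map q)]
      rw [← cfc_const_one ℝ (q (star b * b)) (hsa.map q)]
      refine cfc_congr fun t ht => ?_
      rcases subsingleton_or_nontrivial D with hD | hD
      · simp [spectrum.of_subsingleton] at ht
      have h1 : t ≤ r ^ 2 := by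
        calc t ≤ ‖t‖ := le_abs_self t
          _ ≤ ‖q (star b * b)‖ := spectrum.norm_le_norm_of_mem ht
          _ = ‖q b‖ * ‖q b‖ := by rw [map_mul, map_star, CStarRing.norm_star_mul_self]
          _ ≤ r ^ 2 := by nlinarith [norm_nonneg (q b)]
      have h2 : √t ≤ r := Real.sqrt_le_left hr.le |>.2 h1
      simp [f, max_eq_left h2, hr.ne']
    rw [map_mul, hmap, mul_one]
  · have hsq : ‖b * cfc f (star b * b)‖ * ‖b * cfc f (star b * b)‖ ≤ r ^ 2 := by
      rw [← CStarRing.norm_star_mul_self]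
      have hfs : star (cfc f (star b * b)) = cfc f (star b * b) :=
        (cfc_predicate f (star b * b) : IsSelfAdjoint _)
      have : star (b * cfc f (star b * b)) * (b * cfc f (star b * b))
          = cfc (fun t => f t * t * f t) (star b * b) := by
        rw [cfc_mul (fun t => f t * t) f (star b * b) (by fun_prop) (by fun_prop),
          cfc_mul f (fun t => t) (star b * b) (by fun_prop) (by fun_prop), cfc_id' ℝ (star b * b),
          star_mul, hfs]
        simp only [mul_assoc]
      rw [this]
      refine norm_cfc_le (by positivity) fun t ht => ?_
      have ht0 : 0 ≤ t := spectrum_nonneg_of_nonneg (star_mul_self_nonneg b) ht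
      have h1 : f t * √t ≤ r := by
        simp only [f]
        rw [div_mul_eq_mul_div, div_le_iff₀ (hpos t)]
        exact mul_le_mul_of_nonneg_left (le_max_right _ _) hr.le
      have h0 : 0 ≤ f t := div_nonneg hr.le (hpos t).le
      have h2 : f t * t * f t = (f t * √t) ^ 2 := by
        rw [mul_pow, Real.sq_sqrt ht0]; ring
      rw [h2, Real.norm_of_nonneg (by positivity)]
      exact pow_le_pow_left₀ (by positivity) h1 2
    exact le_of_abs_le (abs_le_of_sq_le_sq (by simpa only [sq] using hsq) hr.le)

section NullNets

variable {B Λ : Type*} [NormedRing B] {F : Filter Λ}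

theorem tendsto_pow_mul_sub_mul_pow {a : Λ → B} (ha : ∀ n : ℕ, ∀ l, ‖a l ^ n‖ ≤ 1)
    {x : B} (hx : Tendsto (fun l => a l * x - x * a l) F (nhds 0)) (n : ℕ) :
    Tendsto (fun l => a l ^ n * x - x * a l ^ n) F (nhds 0) := by
  have hbdd : ∀ n : ℕ, IsBoundedUnder (· ≤ ·) F (norm ∘ fun l => a l ^ n) := fun n =>
    isBoundedUnder_of ⟨1, ha n⟩
  induction n with
  | zero => simpa using tendsto_const_nhds
  | succ n ih =>
    have h1 := isBoundedUnder_le_mul_tendsto_zero (hbdd 1) ih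
    have h2 := hx.zero_mul_isBoundedUnder_le (hbdd n)
    refine (add_zero (0 : B) ▸ h1.add h2).congr fun l => ?_
    rw [pow_one, pow_succ' (a l) n]
    noncomm_ring

theorem tendsto_mul_pow_sub_pow_mul_pow {a : Λ → B} (ha : ∀ n : ℕ, ∀ l, ‖a l ^ n‖ ≤ 1)
    {x : B} (hx : Tendsto (fun l => a l * x - x * a l) F (nhds 0)) (n : ℕ) :
    Tendsto (fun l => (x * a l) ^ n - x ^ n * a l ^ n) F (nhds 0) := by
  have hbdd : IsBoundedUnder (· ≤ ·) F (norm ∘ a) :=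
    isBoundedUnder_of ⟨1, fun l => by simpa using ha 1 l⟩
  induction n with
  | zero => simpa using tendsto_const_nhds
  | succ n ih =>
    have h1 := (zero_mul x ▸ ih.mul_const x).zero_mul_isBoundedUnder_le hbdd
    have h2 := (mul_zero (x ^ n) ▸
      (tendsto_pow_mul_sub_mul_pow ha hx n).const_mul (x ^ n)).zero_mul_isBoundedUnder_le hbdd
    refine (add_zero (0 : B) ▸ h1.add h2).congr fun l => ?_
    simp only [pow_succ]
    noncomm_ring

theorem tendsto_commutator_mul_pow_sub {a : Λ → B} (ha : ∀ n : ℕ, ∀ l, ‖a l ^ n‖ ≤ 1)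
    {x y : B} (hx : Tendsto (fun l => a l * x - x * a l) F (nhds 0))
    (hy : Tendsto (fun l => a l * y - y * a l) F (nhds 0)) (n : ℕ) :
    Tendsto (fun l => ((x * a l) ^ n * y - y * (x * a l) ^ n)
      - (x ^ n * y - y * x ^ n) * a l ^ n) F (nhds 0) := by
  have h := tendsto_mul_pow_sub_pow_mul_pow ha hx n
  have h1 := ((h.mul_const y).add ((tendsto_pow_mul_sub_mul_pow ha hy n).const_mul (x ^ n))).sub
    (h.const_mul y)
  simp only [zero_mul, mul_zero, add_zero, sub_zero] at h1
  refine h1.congr fun l => ?_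
  simp only [mul_sub, sub_mul, mul_assoc]
  abel

end NullNets

/-- Let `B` and `D` be unital C*-algebras, `q : B → D` a surjective ⋆-homomorphism, and
`(i_λ)_{λ ∈ Λ}` a quasicentral approximate unit for the ideal `ker q` (membership in `ker q`
is expressed by `q (i λ) = 0`).  Then for all `x, y ∈ B` and every positive integer `N`,
`limsup_λ ‖[(x(1 - i_λ))^N, y]‖ = ‖[q(x)^N, q(y)]‖`. -/
theorem limsup_commutator_norm_eq_quotient_commutator_norm
    {B D : Type*} [CStarAlgebra B] [PartialOrder B] [StarOrderedRing B] [CStarAlgebra D]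
    {Λ : Type*} [Preorder Λ] [IsDirected Λ (· ≤ ·)] [Nonempty Λ]
    (q : B →⋆ₐ[ℂ] D) (hq : Function.Surjective q)
    (i : Λ → B)
    (h_mem : ∀ l, q (i l) = 0)
    (h_nonneg : ∀ l, 0 ≤ i l) (h_le_one : ∀ l, i l ≤ 1)
    (h_unit_left : ∀ x : B, q x = 0 →
      Tendsto (fun l => ‖i l * x - x‖) atTop (nhds 0))
    (h_unit_right : ∀ x : B, q x = 0 →
      Tendsto (fun l => ‖x * i l - x‖) atTop (nhds 0))
    (h_quasicentral : ∀ b : B,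
      Tendsto (fun l => ‖i l * b - b * i l‖) atTop (nhds 0))
    (x y : B) (N : ℕ) (hN : 0 < N) :
    limsup (fun l => ‖(x * (1 - i l)) ^ N * y - y * (x * (1 - i l)) ^ N‖) atTop
      = ‖(q x) ^ N * q y - q y * (q x) ^ N‖ := by
  have ha1 : ∀ l, ‖1 - i l‖ ≤ 1 := fun l =>
    (CStarAlgebra.norm_le_one_iff_of_nonneg _ (sub_nonneg.2 (h_le_one l))).2
      (sub_le_self _ (h_nonneg l))
  have ha : ∀ n : ℕ, ∀ l, ‖(1 - i l) ^ n‖ ≤ 1 := by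
    intro n l
    rcases subsingleton_or_nontrivial B with hB | hB
    · simp [Subsingleton.elim ((1 - i l) ^ n) 0]
    · exact (norm_pow_le _ n).trans (pow_le_one₀ (norm_nonneg _) (ha1 l))
  have hcomm : ∀ b : B, Tendsto (fun l => (1 - i l) * b - b * (1 - i l)) atTop (nhds 0) := by
    intro b
    have h := (tendsto_zero_iff_norm_tendsto_zero.2 (h_quasicentral b)).neg
    rw [neg_zero] at h
    refine h.congr fun l => ?_
    noncomm_ring
  set c := x ^ N * y - y * x ^ N with hc
  have hqc : (q x) ^ N * q y - q y * (q x) ^ N = q c := by simp [hc]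
  have hlow : ∀ l, ‖q c‖ ≤ ‖(x * (1 - i l)) ^ N * y - y * (x * (1 - i l)) ^ N‖ := by
    intro l
    have h : q c = q ((x * (1 - i l)) ^ N * y - y * (x * (1 - i l)) ^ N) := by
      simp [hc, h_mem]
    rw [h]
    exact NonUnitalStarAlgHom.norm_apply_le q _
  rw [hqc]
  refine Tendsto.limsup_eq ?_
  refine tendsto_order.2 ⟨fun r hr => .of_forall fun l => hr.trans_le (hlow l), fun r hr => ?_⟩
  obtain ⟨s, hs, hsr⟩ := exists_between hr
  obtain ⟨d, hd, hds⟩ :=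
    exists_map_eq_norm_le_of_norm_map_le q c ((norm_nonneg _).trans_lt hs) hs.le
  have hker : Tendsto (fun l => (c - d) * (1 - i l) ^ N) atTop (nhds 0) := by
    obtain ⟨n, rfl⟩ := Nat.exists_eq_add_of_lt hN
    have h := (tendsto_zero_iff_norm_tendsto_zero.2
      (h_unit_right (c - d) (by simp [hd]))).neg
    rw [neg_zero] at h
    have h2 := h.zero_mul_isBoundedUnder_le (isBoundedUnder_of ⟨1, ha n⟩)
    refine h2.congr fun l => ?_
    rw [zero_add, pow_succ', ← mul_assoc]
    congr 1
    noncomm_ring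
  have hlim := ((tendsto_commutator_mul_pow_sub ha (hcomm x) (hcomm y) N).add hker).norm
  simp only [add_zero, norm_zero, ← hc] at hlim
  filter_upwards [hlim.eventually_lt_const (sub_pos.2 hsr)] with l hl
  have hdl : ‖d * (1 - i l) ^ N‖ ≤ s :=
    (norm_mul_le _ _).trans ((mul_le_of_le_one_right (norm_nonneg _) (ha N l)).trans hds)
  have hsplit : (x * (1 - i l)) ^ N * y - y * (x * (1 - i l)) ^ N
      = ((x * (1 - i l)) ^ N * y - y * (x * (1 - i l)) ^ N - c * (1 - i l) ^ N
        + (c - d) * (1 - i l) ^ N) + d * (1 - i l) ^ N := by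
    rw [sub_mul c d]; abel
  rw [hsplit]
  linarith [norm_add_le ((x * (1 - i l)) ^ N * y - y * (x * (1 - i l)) ^ N - c * (1 - i l) ^ N
        + (c - d) * (1 - i l) ^ N) (d * (1 - i l) ^ N)]
end

section
/- Let B and D be unital C*-algebras, let q : B → D be a surjective ⋆-homomorphism, and let (i_λ)_{λ∈Λ} be a quasicentral approximate unit for the ideal I = ker q. Then for every x, y ∈ B and every positive integer N one has limsup_λ ‖[(x(1−i_λ))^N, y]‖ = limsup_λ ‖(1−i_λ)^N [x^N, y]‖. -/
open Filter

open Asymptotics in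
/-- If `c` is a bounded family that asymptotically commutes with `b`, then so do its powers. -/
theorem isLittleO_commutator_pow {A ι : Type*} [NormedRing A] {F : Filter ι} {c : ι → A} {b : A}
    (hc : c =O[F] (fun _ => (1 : ℝ))) (hb : (fun l => c l * b - b * c l) =o[F] (fun _ => (1 : ℝ)))
    (n : ℕ) : (fun l => c l ^ n * b - b * c l ^ n) =o[F] (fun _ => (1 : ℝ)) := by
  induction n with
  | zero => simp [tendsto_const_nhds]
  | succ n ih =>
    have h := (hc.mul_isLittleO ih).add (hb.mul_isBigO (by simpa using hc.pow n))
    simp only [mul_one] at h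
    refine h.congr_left fun l => ?_
    rw [pow_succ' (c l) n]
    noncomm_ring

open Asymptotics in
/-- If `c` is a bounded family that asymptotically commutes with `x`, then `(x c) ^ n` is
asymptotically equal to `c ^ n x ^ n`. -/
theorem isLittleO_mul_pow_sub {A ι : Type*} [NormedRing A] {F : Filter ι} {c : ι → A} {x : A}
    (hc : c =O[F] (fun _ => (1 : ℝ))) (hx : (fun l => c l * x - x * c l) =o[F] (fun _ => (1 : ℝ)))
    (n : ℕ) : (fun l => (x * c l) ^ n - c l ^ n * x ^ n) =o[F] (fun _ => (1 : ℝ)) := by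
  induction n with
  | zero => simp [tendsto_const_nhds]
  | succ n ih =>
    have h₁ := ((isBigO_const_const x one_ne_zero F).mul hc).mul_isLittleO ih
    have h₂ := (isLittleO_commutator_pow hc hx (n + 1)).mul_isBigO
      (isBigO_const_const (x ^ n) (one_ne_zero (α := ℝ)) F)
    simp only [mul_one] at h₁ h₂
    refine (h₁.sub h₂).congr_left fun l => ?_
    rw [pow_succ' (x * c l) n, pow_succ' x n, pow_succ' (c l) n]
    noncomm_ring

open Asymptotics in
/-- If `c` is a bounded family that asymptotically commutes with `x` and `y`, then
`[(x c) ^ n, y]` is asymptotically equal to `c ^ n [x ^ n, y]`. -/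
theorem isLittleO_commutator_mul_pow_sub {A ι : Type*} [NormedRing A] {F : Filter ι} {c : ι → A}
    {x y : A} (hc : c =O[F] (fun _ => (1 : ℝ)))
    (hx : (fun l => c l * x - x * c l) =o[F] (fun _ => (1 : ℝ)))
    (hy : (fun l => c l * y - y * c l) =o[F] (fun _ => (1 : ℝ))) (n : ℕ) :
    (fun l => ((x * c l) ^ n * y - y * (x * c l) ^ n) - c l ^ n * (x ^ n * y - y * x ^ n))
      =o[F] (fun _ => (1 : ℝ)) := by
  have hd := isLittleO_mul_pow_sub hc hx n
  have hconst (a : A) := isBigO_const_const a (one_ne_zero (α := ℝ)) F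
  have h := ((hd.mul_isBigO (hconst y)).sub ((hconst y).mul_isLittleO hd)).add
    ((isLittleO_commutator_pow hc hy n).mul_isBigO (hconst (x ^ n)))
  simp only [mul_one] at h
  refine h.congr_left fun l => ?_
  noncomm_ring

/-- Real families whose difference tends to zero, one of which is bounded, have the same
limit superior. -/
theorem limsup_eq_of_tendsto_sub {ι : Type*} {F : Filter ι} [F.NeBot] {f g : ι → ℝ}
    (hfg : Tendsto (fun l => f l - g l) F (nhds 0))
    (hg_le : F.IsBoundedUnder (· ≤ ·) g) (hg_ge : F.IsBoundedUnder (· ≥ ·) g) :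
    limsup f F = limsup g F := by
  have hf : f = (fun l => f l - g l) + g := by ext; simp
  have h_le := limsup_add_le hfg.isBoundedUnder_ge hfg.isBoundedUnder_le
    hg_ge.isCoboundedUnder_le hg_le
  have h_ge := le_limsup_add hg_le hg_ge.isCoboundedUnder_le
    hfg.isBoundedUnder_le hfg.isBoundedUnder_ge
  rw [← hf, hfg.limsup_eq, zero_add] at h_le
  rw [add_comm g, ← hf, hfg.liminf_eq, add_zero] at h_ge
  exact le_antisymm h_le h_ge

/-- Let `B` and `D` be unital C*-algebras, `q : B → D` a surjective ⋆-homomorphism, and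
`(i_λ)_{λ ∈ Λ}` a quasicentral approximate unit for the ideal `ker q` (membership in `ker q`
is expressed by `q (i λ) = 0`).  Then for all `x, y ∈ B` and every positive integer `N`,
`limsup_λ ‖[(x(1 - i_λ))^N, y]‖ = limsup_λ ‖(1 - i_λ)^N [x^N, y]‖`. -/
theorem limsup_commutator_norm_eq_limsup
    {B D : Type*} [CStarAlgebra B] [PartialOrder B] [StarOrderedRing B] [CStarAlgebra D]
    {Λ : Type*} [Preorder Λ] [IsDirected Λ (· ≤ ·)] [Nonempty Λ]
    (q : B →⋆ₐ[ℂ] D) (hq : Function.Surjective q)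
    (i : Λ → B)
    (h_mem : ∀ l, q (i l) = 0)
    (h_nonneg : ∀ l, 0 ≤ i l) (h_le_one : ∀ l, i l ≤ 1)
    (h_unit_left : ∀ x : B, q x = 0 →
      Tendsto (fun l => ‖i l * x - x‖) atTop (nhds 0))
    (h_unit_right : ∀ x : B, q x = 0 →
      Tendsto (fun l => ‖x * i l - x‖) atTop (nhds 0))
    (h_quasicentral : ∀ b : B,
      Tendsto (fun l => ‖i l * b - b * i l‖) atTop (nhds 0))
    (x y : B) (N : ℕ) (hN : 0 < N) :
    limsup (fun l => ‖(x * (1 - i l)) ^ N * y - y * (x * (1 - i l)) ^ N‖) atTop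
      = limsup (fun l => ‖(1 - i l) ^ N * (x ^ N * y - y * x ^ N)‖) atTop := by
  have hc : (fun l => 1 - i l) =O[atTop] (fun _ => (1 : ℝ)) := by
    refine Asymptotics.IsBigO.of_bound 1 (.of_forall fun l => ?_)
    have h : ‖1 - i l‖ ≤ 1 := (CStarAlgebra.norm_le_one_iff_of_nonneg _
      (sub_nonneg.2 (h_le_one l))).2 (sub_le_self 1 (h_nonneg l))
    simpa using h
  have hcomm (b : B) :
      (fun l => (1 - i l) * b - b * (1 - i l)) =o[atTop] (fun _ => (1 : ℝ)) := by
    rw [Asymptotics.isLittleO_one_iff, tendsto_zero_iff_norm_tendsto_zero]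
    refine (h_quasicentral b).congr fun l => ?_
    rw [← norm_neg]
    congr 1
    noncomm_ring
  have hdiff := isLittleO_commutator_mul_pow_sub hc (hcomm x) (hcomm y) N
  rw [Asymptotics.isLittleO_one_iff] at hdiff
  have hbdd := (hc.pow N).mul
    (Asymptotics.isBigO_const_const (x ^ N * y - y * x ^ N) (one_ne_zero (α := ℝ)) atTop)
  simp only [one_pow, mul_one] at hbdd
  exact limsup_eq_of_tendsto_sub
    (squeeze_zero_norm (fun l => abs_norm_sub_norm_le _ _)
      (tendsto_zero_iff_norm_tendsto_zero.1 hdiff))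
    ((Asymptotics.isBigO_one_iff ℝ).1 hbdd)
    (isBoundedUnder_of ⟨0, fun l => norm_nonneg _⟩)
end

section
/- Let B and D be unital C*-algebras and let q : B → D be a surjective unital ⋆-homomorphism. Let u ∈ D be a unitary and let a_1, …, a_N ∈ D satisfy [a_i, u] = 0 for i = 1, …, N. Let A_1, …, A_N ∈ B be elements with q(A_i) = a_i for each i, and let ε > 0. Then there exists a unitary V in the C*-algebra M₂(B) of 2×2 matrices over B such that the entrywise image of V under q equals the diagonal matrix diag(u, −u*), and ‖[diag(A_i, A_i), V]‖ ≤ ε for i = 1, …, N. -/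
/-- A unitary of a quotient C⋆-algebra lifts to a contraction. -/
lemma exists_contraction_lift {B D : Type*} [CStarAlgebra B] [CStarAlgebra D]
    (q : B →⋆ₐ[ℂ] D) (hq : Function.Surjective q) {u : D} (hu : star u * u = 1) :
    ∃ U : B, q U = u ∧ ‖U‖ ≤ 1 := by
  obtain ⟨U, rfl⟩ := hq u
  set f : ℝ → ℝ := fun t => (√(max 1 |t|))⁻¹ with hf
  have hfpos (t : ℝ) : 0 < √(max 1 |t|) := Real.sqrt_pos.2 (by positivity)
  have hfc : Continuous f := by
    refine Continuous.inv₀ (by fun_prop) fun t => (hfpos t).ne'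
  have hh : IsSelfAdjoint (star U * U) := .star_mul_self U
  have hqc : Continuous q := AddMonoidHomClass.continuous_of_bound q 1
    (by simpa only [one_mul] using NonUnitalStarAlgHom.norm_apply_le q)
  refine ⟨U * cfc f (star U * U), ?_, ?_⟩
  · rw [map_mul, StarAlgHomClass.map_cfc q f (star U * U) hfc.continuousOn hqc hh (hh.map q),
      map_mul, map_star, hu]
    simp [hf]
  · have hs : star (cfc f (star U * U)) = cfc f (star U * U) := cfc_predicate f (star U * U)
    have key : star (U * cfc f (star U * U)) * (U * cfc f (star U * U)) =
        cfc (fun t => f t * t * f t) (star U * U) := by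
      rw [cfc_mul (fun t => f t * t) f _ (by fun_prop) hfc.continuousOn,
        cfc_mul f (fun t => t) _ hfc.continuousOn, cfc_id' ℝ (star U * U), star_mul, hs]
      simp only [mul_assoc]
    have : ‖U * cfc f (star U * U)‖ * ‖U * cfc f (star U * U)‖ ≤ 1 := by
      rw [← CStarRing.norm_star_mul_self, key]
      refine norm_cfc_le zero_le_one fun t _ => ?_
      have h1 : f t * f t = (max 1 |t|)⁻¹ := by
        rw [hf, ← mul_inv, Real.mul_self_sqrt (by positivity)]
      rw [show f t * t * f t = (f t * f t) * t by ring, h1, norm_mul, norm_inv, Real.norm_eq_abs,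
        Real.norm_eq_abs, abs_of_pos (by positivity), inv_mul_le_one₀ (by positivity)]
      exact le_max_right _ _
    nlinarith [norm_nonneg (U * cfc f (star U * U))]

/-- Approximate units of the kernel of `q`, in terms of the complement `g = 1 - e`. -/
lemma exists_approx_annihilator {B D : Type*} [CStarAlgebra B] [CStarAlgebra D]
    (q : B →⋆ₐ[ℂ] D) (X : Finset B) (hX : ∀ x ∈ X, q x = 0) {δ : ℝ} (hδ : 0 < δ) :
    ∃ g : B, IsSelfAdjoint g ∧ ‖g‖ ≤ 1 ∧ q g = 1 ∧ ∀ x ∈ X, ‖x * g‖ ≤ δ := by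
  let _ := CStarAlgebra.spectralOrder B
  let _ := CStarAlgebra.spectralOrderedRing B
  set h : B := ∑ x ∈ X, star x * x with hh
  have hsa : IsSelfAdjoint h := isSelfAdjoint_sum _ fun x _ => .star_mul_self x
  set f : ℝ → ℝ := fun t => δ ^ 2 / (δ ^ 2 + |t|) with hf
  have hpos (t : ℝ) : 0 < δ ^ 2 + |t| := by positivity
  have hfc : Continuous f := by
    refine Continuous.div (by fun_prop) (by fun_prop) fun t => (hpos t).ne'
  have hqc : Continuous q := AddMonoidHomClass.continuous_of_bound q 1
    (by simpa only [one_mul] using NonUnitalStarAlgHom.norm_apply_le q)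
  have hf0 (t : ℝ) : 0 ≤ f t := by positivity
  have hf1 (t : ℝ) : f t ≤ 1 := by
    rw [hf, div_le_one (hpos t)]; linarith [abs_nonneg t]
  have hs : star (cfc f h) = cfc f h := cfc_predicate f h
  have hqh : q h = 0 := by
    rw [hh, map_sum]
    exact Finset.sum_eq_zero fun x hx => by rw [map_mul, hX x hx, mul_zero]
  have hghg : ‖cfc f h * h * cfc f h‖ ≤ δ ^ 2 := by
    have key : cfc f h * h * cfc f h = cfc (fun t => f t * t * f t) h := by
      rw [cfc_mul (fun t => f t * t) f _ (by fun_prop) hfc.continuousOn,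
        cfc_mul f (fun t => t) _ hfc.continuousOn, cfc_id' ℝ h]
    rw [key]
    refine norm_cfc_le (by positivity) fun t _ => ?_
    have h1 : f t * |t| ≤ δ ^ 2 := by
      rw [hf, div_mul_eq_mul_div, div_le_iff₀ (hpos t)]
      nlinarith [sq_nonneg δ, sq_nonneg (δ ^ 2)]
    rw [norm_mul, norm_mul, Real.norm_eq_abs, Real.norm_eq_abs, abs_of_nonneg (hf0 t)]
    nlinarith [hf1 t, hf0 t, mul_nonneg (hf0 t) (abs_nonneg t)]
  refine ⟨cfc f h, hs, norm_cfc_le zero_le_one fun t _ => ?_, ?_, fun x hx => ?_⟩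
  · rw [Real.norm_eq_abs, abs_of_nonneg (hf0 t)]; exact hf1 t
  · rw [StarAlgHomClass.map_cfc q f h hfc.continuousOn hqc hsa (hsa.map q), hqh]
    simp [hf, hδ.ne']
  · refine (sq_le_sq₀ (norm_nonneg _) hδ.le).1 ?_
    rw [sq, ← CStarRing.norm_star_mul_self]
    refine (CStarAlgebra.norm_le_norm_of_nonneg_of_le (star_mul_self_nonneg _) ?_).trans hghg
    have hxh : star x * x ≤ h :=
      Finset.single_le_sum (f := fun x => star x * x) (fun y _ => star_mul_self_nonneg y) hx
    have := star_left_conjugate_le_conjugate hxh (cfc f h)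
    rw [hs] at this
    rwa [star_mul, hs, mul_assoc, ← mul_assoc (star x), ← mul_assoc]

/-- Quasicentral approximate units of the kernel of `q`, in terms of the complement `g = 1 - e`.
The bound on the commutators improves by averaging two almost orthogonal choices. -/
lemma exists_quasicentral_pow {B D : Type*} [CStarAlgebra B] [CStarAlgebra D]
    (q : B →⋆ₐ[ℂ] D) {ι : Type*} [Fintype ι] (A : ι → B) {C : ℝ} (hC : 0 < C)
    (hAC : ∀ i, 2 * ‖A i‖ ≤ C) (n : ℕ) :
    ∀ (X : Finset B), (∀ x ∈ X, q x = 0) → ∀ δ : ℝ, 0 < δ →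
    ∃ g : B, IsSelfAdjoint g ∧ ‖g‖ ≤ 1 ∧ q g = 1 ∧ (∀ x ∈ X, ‖x * g‖ ≤ δ) ∧
      ∀ i, ‖A i * g - g * A i‖ ≤ C * (9 / 10) ^ n := by
  classical
  induction n with
  | zero =>
    intro X hX δ hδ
    obtain ⟨g, h1, h2, h3, h4⟩ := exists_approx_annihilator q X hX hδ
    refine ⟨g, h1, h2, h3, h4, fun i => ?_⟩
    have e1 := norm_sub_le (A i * g) (g * A i)
    have e2 := norm_mul_le (A i) g
    have e3 := norm_mul_le g (A i)
    have := hAC i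
    have := norm_nonneg (A i)
    rw [pow_zero, mul_one]
    nlinarith
  | succ n ih =>
    intro X hX δ hδ
    set c : ℝ := C * (9 / 10) ^ n with hc
    have hcpos : 0 < c := by positivity
    obtain ⟨g, g1, g2, g3, g4, g5⟩ := ih X hX δ hδ
    set y : ι → B := fun i => A i * g - g * A i with hy
    have hqy (i) : q (star (y i)) = 0 := by simp [hy, map_star, g3]
    set η : ℝ := min δ (c ^ 2 / 2 / (1 + C)) with hη
    have hηpos : 0 < η := by positivity
    obtain ⟨g', k1, k2, k3, k4, k5⟩ := ih
      (X ∪ (Finset.univ.image (fun i => star (y i)) ∪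
        Finset.univ.image (fun i => star (y i) * A i))) (by
        intro x hx
        simp only [Finset.mem_union, Finset.mem_image, Finset.mem_univ, true_and] at hx
        rcases hx with hx | ⟨i, rfl⟩ | ⟨i, rfl⟩
        · exact hX x hx
        · exact hqy i
        · rw [map_mul, hqy, zero_mul]) η hηpos
    have hm (z : B) : ‖((1 / 2 : ℝ) • z)‖ = 1 / 2 * ‖z‖ := by
      rw [norm_smul]; norm_num
    refine ⟨(1 / 2 : ℝ) • (g + g'), ?_, ?_, ?_, fun x hx => ?_, fun i => ?_⟩
    · exact (IsSelfAdjoint.all (1 / 2 : ℝ)).smul (g1.add k1)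
    · rw [hm]; linarith [norm_add_le g g']
    · have : q ((1 / 2 : ℝ) • (g + g')) = (1 / 2 : ℝ) • q (g + g') := by
        rw [← Complex.coe_smul, map_smul, Complex.coe_smul]
      rw [this, map_add, g3, k3, ← two_smul ℝ (1 : D), smul_smul]
      norm_num
    · rw [mul_smul_comm, hm, mul_add]
      have := k4 x (by simp [hx])
      linarith [norm_add_le (x * g) (x * g'), g4 x hx, min_le_left δ (c ^ 2 / 2 / (1 + C))]
    · set y' : B := A i * g' - g' * A i with hy'
      have e0 : A i * ((1 / 2 : ℝ) • (g + g')) - ((1 / 2 : ℝ) • (g + g')) * A i =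
          (1 / 2 : ℝ) • (y i + y') := by
        rw [mul_smul_comm, smul_mul_assoc, ← smul_sub, hy, hy']
        congr 1
        noncomm_ring
      have o1 : ‖star (y i) * y'‖ ≤ c ^ 2 / 2 := by
        have a1 := k4 (star (y i)) (by simp)
        have a2 := k4 (star (y i) * A i) (by simp)
        have a3 : star (y i) * y' = star (y i) * A i * g' - star (y i) * g' * A i := by
          rw [hy']; noncomm_ring
        have a4 := norm_mul_le (star (y i) * g') (A i)
        have a5 := norm_sub_le (star (y i) * A i * g') (star (y i) * g' * A i)
        have a6 : η * (1 + C) ≤ c ^ 2 / 2 := by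
          rw [← le_div_iff₀ (by positivity)]; exact min_le_right _ _
        rw [a3]
        have := hAC i
        have := norm_nonneg (A i)
        nlinarith
      have o2 : ‖star y' * y i‖ ≤ c ^ 2 / 2 := by
        rw [← norm_star, star_mul, star_star]; exact o1
      have o3 : ‖star (y i) * y i‖ ≤ c ^ 2 := by
        rw [CStarRing.norm_star_mul_self]; nlinarith [g5 i, norm_nonneg (y i)]
      have o4 : ‖star y' * y'‖ ≤ c ^ 2 := by
        rw [CStarRing.norm_star_mul_self]; nlinarith [k5 i, norm_nonneg y']
      have o5 : ‖y i + y'‖ * ‖y i + y'‖ ≤ 3 * c ^ 2 := by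
        rw [← CStarRing.norm_star_mul_self]
        have : star (y i + y') * (y i + y') =
            star (y i) * y i + star (y i) * y' + star y' * y i + star y' * y' := by
          rw [star_add]; noncomm_ring
        rw [this]
        refine (norm_add_le _ _).trans ?_
        linarith [norm_add₃_le (a := star (y i) * y i) (b := star (y i) * y')
          (c := star y' * y i)]
      rw [e0, hm, pow_succ, ← mul_assoc, ← hc]
      have : ‖y i + y'‖ ≤ 9 / 5 * c := by
        refine abs_le_of_sq_le_sq' ?_ (by positivity) |>.2
        nlinarith
      linarith

/-- Lifts of a unitary `u` to contractions which almost commute with given elements whose images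
commute with `u`. -/
lemma exists_almost_commuting_lift {B D : Type*} [CStarAlgebra B] [CStarAlgebra D]
    (q : B →⋆ₐ[ℂ] D) (hq : Function.Surjective q) {ι : Type*} [Fintype ι] (A : ι → B)
    {u : D} (hu : u ∈ unitary D) (hA : ∀ i, Commute (q (A i)) u) {δ : ℝ} (hδ : 0 < δ) :
    ∃ U : B, q U = u ∧ ‖U‖ ≤ 1 ∧ ∀ i, ‖A i * U - U * A i‖ ≤ δ ∧
      ‖A i * star U - star U * A i‖ ≤ δ := by
  classical
  obtain ⟨U, hqU, hU⟩ := exists_contraction_lift q hq hu.1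
  have hA' (i) : Commute (q (A i)) (star u) := by
    have h := hA i
    have h1 := hu.1
    have h2 := hu.2
    calc q (A i) * star u = (star u * u) * q (A i) * star u := by rw [h1, one_mul]
      _ = star u * (q (A i) * u) * star u := by rw [h.eq]; simp only [mul_assoc]
      _ = star u * q (A i) := by rw [mul_assoc, mul_assoc, h2, mul_one]
  set C : ℝ := 1 + ∑ i, 2 * ‖A i‖ with hC
  have hsum : 0 ≤ ∑ i, 2 * ‖A i‖ := Finset.sum_nonneg fun i _ => by positivity
  have hCpos : 0 < C := by positivity
  have hAC (i) : 2 * ‖A i‖ ≤ C := by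
    have := Finset.single_le_sum (f := fun i => 2 * ‖A i‖) (fun i _ => by positivity)
      (Finset.mem_univ i)
    linarith
  obtain ⟨n, hn⟩ := exists_pow_lt_of_lt_one (show 0 < δ / 2 / C by positivity)
    (show (9 / 10 : ℝ) < 1 by norm_num)
  have hn' : C * (9 / 10) ^ n ≤ δ / 2 := by
    rw [lt_div_iff₀ hCpos] at hn; linarith
  obtain ⟨g, g1, g2, g3, g4, g5⟩ := exists_quasicentral_pow q A hCpos hAC n
    (Finset.univ.image (fun i => A i * U - U * A i) ∪
      Finset.univ.image (fun i => star (A i * star U - star U * A i))) (by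
      intro x hx
      simp only [Finset.mem_union, Finset.mem_image, Finset.mem_univ, true_and] at hx
      rcases hx with ⟨i, rfl⟩ | ⟨i, rfl⟩
      · rw [map_sub, map_mul, map_mul, hqU, (hA i).eq, sub_self]
      · rw [map_star, map_sub, map_mul, map_mul, map_star, hqU, (hA' i).eq, sub_self, star_zero])
    (δ / 2) (by positivity)
  refine ⟨U * g, by rw [map_mul, hqU, g3, mul_one], ?_, fun i => ⟨?_, ?_⟩⟩
  · exact (norm_mul_le _ _).trans (mul_le_one₀ hU (norm_nonneg _) g2)
  · have e : A i * (U * g) - U * g * A i =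
        (A i * U - U * A i) * g + U * (A i * g - g * A i) := by noncomm_ring
    have e1 := g4 (A i * U - U * A i) (by simp)
    have e2 := norm_mul_le U (A i * g - g * A i)
    have e3 := g5 i
    have e4 := mul_le_of_le_one_left (norm_nonneg (A i * g - g * A i)) hU
    rw [e]
    exact (norm_add_le _ _).trans (by linarith)
  · have e : A i * star (U * g) - star (U * g) * A i =
        (A i * g - g * A i) * star U + star (star (A i * star U - star U * A i) * g) := by
      rw [star_mul, star_mul, star_star, g1.star_eq]; noncomm_ring
    have e1 := g4 (star (A i * star U - star U * A i)) (by simp)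
    have e2 := norm_mul_le (A i * g - g * A i) (star U)
    have e3 := g5 i
    have e4 := mul_le_of_le_one_right (norm_nonneg (A i * g - g * A i)) hU
    rw [norm_star] at e2
    rw [e]
    refine (norm_add_le _ _).trans ?_
    rw [norm_star]
    linarith

open Polynomial in
/-- On the unit ball, `P ↦ [a, p(P)]` is controlled by `[a, P]` for each polynomial `p`. -/
lemma exists_norm_commutator_aeval_le (p : ℝ[X]) : ∃ L : ℝ, 0 ≤ L ∧
    ∀ {E : Type*} [CStarAlgebra E] (a P : E), ‖P‖ ≤ 1 →
      ‖a * aeval P p - aeval P p * a‖ ≤ L * ‖a * P - P * a‖ := by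
  induction p using Polynomial.induction_on with
  | C r =>
    refine ⟨0, le_rfl, fun a P _ => ?_⟩
    rw [aeval_C, Algebra.commutes, sub_self]; simp
  | add p₁ p₂ h₁ h₂ =>
    obtain ⟨L₁, h₁, H₁⟩ := h₁
    obtain ⟨L₂, h₂, H₂⟩ := h₂
    refine ⟨L₁ + L₂, by positivity, fun a P hP => ?_⟩
    rw [map_add, mul_add, add_mul, add_sub_add_comm, add_mul]
    exact (norm_add_le _ _).trans (add_le_add (H₁ a P hP) (H₂ a P hP))
  | monomial n r h =>
    obtain ⟨L, hL, H⟩ := h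
    refine ⟨L + |r|, by positivity, fun {E} _ a P hP => ?_⟩
    have h0 := H a P hP
    have e : aeval P (C r * X ^ (n + 1)) = aeval P (C r * X ^ n) * P := by
      simp [pow_succ, mul_assoc]
    have hpow (m : ℕ) (x : E) : ‖P ^ m * x‖ ≤ ‖x‖ := by
      induction m generalizing x with
      | zero => simp
      | succ m ihm =>
        rw [pow_succ, mul_assoc]
        exact (ihm _).trans ((norm_mul_le _ _).trans (mul_le_of_le_one_left (norm_nonneg _) hP))
    have hQ : ‖aeval P (C r * X ^ n) * (a * P - P * a)‖ ≤ |r| * ‖a * P - P * a‖ := by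
      have e' : aeval P (C r * X ^ n) = r • P ^ n := by simp [Algebra.smul_def]
      rw [e', smul_mul_assoc, norm_smul, Real.norm_eq_abs]
      exact mul_le_mul_of_nonneg_left (hpow n _) (abs_nonneg r)
    set Q := aeval P (C r * X ^ n)
    have e2 : a * (Q * P) - Q * P * a = (a * Q - Q * a) * P + Q * (a * P - P * a) := by
      noncomm_ring
    have e3 := norm_mul_le (a * Q - Q * a) P
    have e4 := mul_le_of_le_one_right (norm_nonneg (a * Q - Q * a)) hP
    rw [e, e2, add_mul]
    exact (norm_add_le _ _).trans (by linarith)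

/-- Elements almost commuting with a self-adjoint contraction `P` almost commute with `f(P)`. -/
lemma exists_norm_commutator_cfc_le {f : ℝ → ℝ} (hf : Continuous f) {K ε : ℝ} (hK : 0 ≤ K)
    (hε : 0 < ε) : ∃ δ : ℝ, 0 < δ ∧
    ∀ {E : Type*} [CStarAlgebra E] (a P : E), IsSelfAdjoint P → ‖P‖ ≤ 1 → ‖a‖ ≤ K →
      ‖a * P - P * a‖ ≤ δ → ‖a * cfc f P - cfc f P * a‖ ≤ ε := by
  obtain ⟨p, hp⟩ := exists_polynomial_near_of_continuousOn (-1) 1 f hf.continuousOn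
    (ε / 4 / (1 + K)) (by positivity)
  obtain ⟨L, hL, H⟩ := exists_norm_commutator_aeval_le p
  refine ⟨ε / 2 / (1 + L), by positivity, fun {E} _ a P hP hP1 ha hc => ?_⟩
  have hd : ‖cfc f P - Polynomial.aeval P p‖ ≤ ε / 4 / (1 + K) := by
    rw [← cfc_polynomial p P hP, ← cfc_sub f _ P hf.continuousOn (by fun_prop)]
    refine norm_cfc_le (by positivity) fun t ht => ?_
    have ht' : ‖t‖ ≤ 1 := by
      rw [← cfc_id' ℝ P hP] at hP1
      exact (norm_cfc_le_iff (fun x : ℝ => x) P zero_le_one).1 hP1 t ht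
    rw [Real.norm_eq_abs, abs_sub_comm]
    exact (hp t (abs_le.1 ht')).le
  set Q := Polynomial.aeval P p
  set R := cfc f P
  have h1 : ‖a * Q - Q * a‖ ≤ ε / 2 := by
    refine (H a P hP1).trans ((mul_le_mul_of_nonneg_left hc hL).trans ?_)
    rw [mul_div_assoc', div_le_iff₀ (by positivity)]
    nlinarith
  have h2 : (1 + K) * ‖R - Q‖ ≤ ε / 4 := by
    rwa [le_div_iff₀' (by positivity)] at hd
  have e : a * R - R * a = (a * Q - Q * a) + (a * (R - Q) - (R - Q) * a) := by noncomm_ring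
  have e1 := norm_sub_le (a * (R - Q)) ((R - Q) * a)
  have e2 := norm_mul_le a (R - Q)
  have e3 := norm_mul_le (R - Q) a
  have e4 := mul_le_mul_of_nonneg_right ha (norm_nonneg (R - Q))
  rw [e]
  refine (norm_add_le _ _).trans ?_
  nlinarith [norm_nonneg (R - Q)]

/-- The C⋆-norm of a diagonal matrix is at most the maximum of the norms of its entries. -/
lemma norm_map_diagonal_le {B E : Type*} [CStarAlgebra B] [CStarAlgebra E]
    (Φ : Matrix (Fin 2) (Fin 2) B ≃⋆ₐ[ℂ] E) (x y : B) :
    ‖Φ (Matrix.diagonal ![x, y])‖ ≤ max ‖x‖ ‖y‖ := by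
  let Δ : B × B →⋆ₙₐ[ℂ] E :=
    { toFun z := Φ (Matrix.diagonal ![z.1, z.2])
      map_smul' c z := by
        rw [MonoidHom.id_apply, ← map_smul]
        congr 1; ext i j; fin_cases i <;> fin_cases j <;> simp
      map_zero' := by
        rw [← map_zero Φ]
        congr 1; ext i j; fin_cases i <;> fin_cases j <;> simp
      map_add' z w := by
        rw [← map_add]
        congr 1; ext i j; fin_cases i <;> fin_cases j <;> simp
      map_mul' z w := by
        rw [← map_mul]
        congr 1; ext i j; fin_cases i <;> fin_cases j <;> simp
      map_star' z := by
        rw [← map_star]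
        congr 1; ext i j; fin_cases i <;> fin_cases j <;> simp [Matrix.star_apply] }
  exact NonUnitalStarAlgHom.norm_apply_le Δ (x, y)

/-- Entrywise application of `q`, out of a C⋆-algebra isomorphic to the matrices over `B`. -/
noncomputable def matrixMapHom {B D E : Type*} [CStarAlgebra B] [CStarAlgebra D] [CStarAlgebra E]
    (q : B →⋆ₐ[ℂ] D) (Φ : Matrix (Fin 2) (Fin 2) B ≃⋆ₐ[ℂ] E) :
    E →⋆ₐ[ℂ] CStarMatrix (Fin 2) (Fin 2) D :=
  { toFun z := CStarMatrix.ofMatrix ((Φ.symm z).map q)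
    map_one' := by rw [map_one, Matrix.map_one q (map_zero q) (map_one q)]; rfl
    map_mul' z w := by rw [map_mul, Matrix.map_mul]; rfl
    map_zero' := by rw [map_zero, Matrix.map_zero q (map_zero q)]; rfl
    map_add' z w := by rw [map_add, Matrix.map_add q (map_add q)]; rfl
    commutes' r := by
      ext i j
      rw [Algebra.algebraMap_eq_smul_one, map_smul, map_one, Algebra.algebraMap_eq_smul_one]
      fin_cases i <;> fin_cases j <;> simp
    map_star' z := by
      ext i j
      rw [map_star]
      simp [Matrix.star_apply, CStarMatrix.star_apply, map_star] }

lemma map_cfc_sqrt_one_sub_eq_zero {E G : Type*} [CStarAlgebra E] [CStarAlgebra G]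
    (Ψ : E →⋆ₐ[ℂ] G) {P : E} (hP : IsSelfAdjoint P) (h : Ψ P = 1) :
    Ψ (cfc (fun t : ℝ => √(1 - t)) P) = 0 := by
  have hΨc : Continuous Ψ := AddMonoidHomClass.continuous_of_bound Ψ 1
    (by simpa only [one_mul] using NonUnitalStarAlgHom.norm_apply_le Ψ)
  rw [StarAlgHomClass.map_cfc Ψ (fun t : ℝ => √(1 - t)) P (by fun_prop) hΨc hP (hP.map Ψ), h,
    cfc_apply_one, sub_self, Real.sqrt_zero, map_zero]

/-- Let `q : B → D` be a surjective unital ⋆-homomorphism of unital C*-algebras, `u ∈ D` a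
unitary, `a_1, …, a_N ∈ D` commuting with `u`, `A_1, …, A_N ∈ B` lifts of the `a_i`, and
`ε > 0`.  Then `diag(u, -u*)` lifts to a unitary `V ∈ M₂(B)` with
`‖[diag(A_i, A_i), V]‖ ≤ ε` for all `i`.

Since the C*-norm of `M₂(B)` is unique, we express it by means of an arbitrary C*-algebra `E`
that is ⋆-algebra isomorphic to the 2×2 matrices over `B` via `Φ` (such an `E` always exists,
and its norm is the unique C*-norm of `M₂(B)`). -/
theorem exists_unitary_lift_of_diag
    {B D : Type*} [CStarAlgebra B] [CStarAlgebra D]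
    (q : B →⋆ₐ[ℂ] D) (hq : Function.Surjective q)
    {E : Type*} [CStarAlgebra E] (Φ : Matrix (Fin 2) (Fin 2) B ≃⋆ₐ[ℂ] E)
    {N : ℕ} (u : D) (hu : u ∈ unitary D)
    (a : Fin N → D) (ha : ∀ i, a i * u = u * a i)
    (A : Fin N → B) (hA : ∀ i, q (A i) = a i)
    (ε : ℝ) (hε : 0 < ε) :
    ∃ V : Matrix (Fin 2) (Fin 2) B,
      V ∈ unitary (Matrix (Fin 2) (Fin 2) B) ∧
      V.map q = Matrix.diagonal ![u, -(star u)] ∧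
      ∀ i : Fin N,
        ‖Φ (Matrix.diagonal ![A i, A i]) * Φ V - Φ V * Φ (Matrix.diagonal ![A i, A i])‖ ≤ ε := by
  set f : ℝ → ℝ := fun t => √(1 - t) with hf
  have hfc : Continuous f := by fun_prop
  set K : ℝ := ∑ i, ‖A i‖
  have hAK (i) : ‖A i‖ ≤ K :=
    Finset.single_le_sum (f := fun i => ‖A i‖) (fun i _ => norm_nonneg _) (Finset.mem_univ i)
  have hK : 0 ≤ K := Finset.sum_nonneg fun i _ => norm_nonneg _
  obtain ⟨δ, hδ, H⟩ := exists_norm_commutator_cfc_le hfc hK (half_pos hε)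
  obtain ⟨U, hqU, hU1, hU⟩ := exists_almost_commuting_lift q hq A hu
    (fun i => by rw [hA]; exact ha i) (δ := min (δ / 2) (ε / 2)) (by positivity)
  have hUs1 : ‖star U‖ ≤ 1 := by rwa [norm_star]
  set P : E := Φ (Matrix.diagonal ![U * star U, star U * U]) with hPdef
  set G : E := Φ !![0, U; -star U, 0] with hG
  set F : E := Φ !![0, 1; 1, 0] with hF
  set R : E := cfc f P with hR
  have hGs : star G = -G := by
    rw [hG, ← map_star, ← map_neg]
    congr 1; ext i j; fin_cases i <;> fin_cases j <;> simp [Matrix.star_apply]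
  have hGG : G * G = -P := by
    rw [hG, hPdef, ← map_mul, ← map_neg]
    congr 1; ext i j; fin_cases i <;> fin_cases j <;> simp
  have hFs : star F = F := by
    rw [hF, ← map_star]
    congr 1; ext i j; fin_cases i <;> fin_cases j <;> simp [Matrix.star_apply]
  have hFF : F * F = 1 := by
    rw [hF, ← map_mul, ← map_one Φ]
    congr 1; ext i j; fin_cases i <;> fin_cases j <;> simp
  have hGF : G * F = Φ (Matrix.diagonal ![U, -star U]) := by
    rw [hF, hG, ← map_mul]
    congr 1; ext i j; fin_cases i <;> fin_cases j <;> simp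
  have hF1 : ‖F‖ ≤ 1 := by
    have h1 : ‖F‖ * ‖F‖ ≤ 1 := by
      rw [← CStarRing.norm_star_mul_self, hFs, hFF]
      obtain _ | _ := subsingleton_or_nontrivial E
      · rw [Subsingleton.elim (1 : E) 0, norm_zero]; exact zero_le_one
      · rw [CStarRing.norm_one]
    nlinarith [norm_nonneg F]
  have hPs : IsSelfAdjoint P := by
    rw [← neg_neg P, ← hGG, isSelfAdjoint_iff, star_neg, star_mul, hGs, neg_mul_neg]
  have hP1 : ‖P‖ ≤ 1 := (norm_map_diagonal_le Φ _ _).trans <| max_le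
    ((norm_mul_le _ _).trans (mul_le_one₀ hU1 (norm_nonneg _) hUs1))
    ((norm_mul_le _ _).trans (mul_le_one₀ hUs1 (norm_nonneg _) hU1))
  have hRs : star R = R := cfc_predicate f P
  have hRG : R * G = G * R := by
    refine (Commute.cfc_real ?_ f).eq
    rw [← neg_neg P, ← hGG]
    exact ((Commute.refl G).mul_left (Commute.refl G)).neg_left
  have hRR : R * R = 1 - P := by
    have h1 : 1 - P = cfc (fun t : ℝ => 1 - t) P := by
      rw [cfc_sub (fun _ => (1 : ℝ)) (fun t => t) P, cfc_const_one ℝ P, cfc_id' ℝ P]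
    rw [h1, hR, ← cfc_mul f f P hfc.continuousOn hfc.continuousOn]
    refine cfc_congr fun t ht => Real.mul_self_sqrt ?_
    rw [← cfc_id' ℝ P hPs] at hP1
    have := (norm_cfc_le_iff (fun x : ℝ => x) P zero_le_one).1 hP1 t ht
    linarith [(abs_le.1 this).2]
  have hW : (R + G) * F ∈ unitary E := by
    have hs : star ((R + G) * F) = F * (R - G) := by
      rw [star_mul, star_add, hFs, hRs, hGs, sub_eq_add_neg]
    have h1 : (R - G) * (R + G) = 1 := by
      rw [sub_mul, mul_add, mul_add, hRG, hGG, hRR]; abel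
    have h2 : (R + G) * (R - G) = 1 := by
      rw [add_mul, mul_sub, mul_sub, hRG, hGG, hRR]; abel
    refine Unitary.mem_iff.2 ⟨?_, ?_⟩ <;> rw [hs]
    · rw [mul_assoc, ← mul_assoc (R - G), h1, one_mul, hFF]
    · rw [mul_assoc, ← mul_assoc F, hFF, one_mul, h2]
  refine ⟨Φ.symm ((R + G) * F), ?_, ?_, fun i => ?_⟩
  · rw [Unitary.mem_iff] at hW ⊢
    rw [← map_star, ← map_mul, ← map_mul, hW.1, hW.2, map_one]
    exact ⟨rfl, rfl⟩
  · have hR0 : (Φ.symm R).map q = 0 := by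
      let _ := CStarAlgebra.spectralOrder D
      have _ := CStarAlgebra.spectralOrderedRing D
      refine map_cfc_sqrt_one_sub_eq_zero (matrixMapHom q Φ) hPs ?_
      change (Φ.symm P).map q = 1
      have h1 := hu.1
      have h2 := hu.2
      rw [hPdef, StarAlgEquiv.symm_apply_apply]
      ext i j; fin_cases i <;> fin_cases j <;> simp [hqU, h1, h2, map_star]
    rw [add_mul, hGF, map_add, map_mul, StarAlgEquiv.symm_apply_apply, Matrix.map_add q (map_add q),
      Matrix.map_mul, hR0, zero_mul, zero_add]
    ext i j; fin_cases i <;> fin_cases j <;> simp [hqU, map_star]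
  · obtain ⟨c1, c2⟩ := hU i
    have m1 := min_le_left (δ / 2) (ε / 2)
    have m2 := min_le_right (δ / 2) (ε / 2)
    rw [StarAlgEquiv.apply_symm_apply]
    set T : E := Φ (Matrix.diagonal ![A i, A i]) with hT
    have hTF : T * F = F * T := by
      rw [hT, hF, ← map_mul, ← map_mul]
      congr 1; ext i j; fin_cases i <;> fin_cases j <;> simp
    have hTP : ‖T * P - P * T‖ ≤ δ := by
      have e : T * P - P * T = Φ (Matrix.diagonal
          ![(A i * U - U * A i) * star U + U * (A i * star U - star U * A i),
            (A i * star U - star U * A i) * U + star U * (A i * U - U * A i)]) := by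
        rw [hT, hPdef, ← map_mul, ← map_mul, ← map_sub]
        congr 1; ext i j; fin_cases i <;> fin_cases j <;> simp <;> noncomm_ring
      have b {x y v w : B} (hx : ‖x‖ ≤ δ / 2) (hy : ‖y‖ ≤ δ / 2) (hv : ‖v‖ ≤ 1) (hw : ‖w‖ ≤ 1) :
          ‖x * v + w * y‖ ≤ δ := by
        have := mul_le_of_le_one_right (norm_nonneg x) hv
        have := mul_le_of_le_one_left (norm_nonneg y) hw
        linarith [norm_add_le (x * v) (w * y), norm_mul_le x v, norm_mul_le w y]
      rw [e]
      exact (norm_map_diagonal_le Φ _ _).trans (max_le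
        (b (c1.trans m1) (c2.trans m1) hUs1 hU1) (b (c2.trans m1) (c1.trans m1) hU1 hUs1))
    have hTR : ‖T * R - R * T‖ ≤ ε / 2 := by
      refine H T P hPs hP1 ((norm_map_diagonal_le Φ _ _).trans ?_) hTP
      rw [max_self]; exact hAK i
    have hTN : ‖T * (G * F) - G * F * T‖ ≤ ε / 2 := by
      have e : T * (G * F) - G * F * T = Φ (Matrix.diagonal
          ![A i * U - U * A i, -(A i * star U - star U * A i)]) := by
        rw [hGF, hT, ← map_mul, ← map_mul, ← map_sub]
        congr 1; ext i j; fin_cases i <;> fin_cases j <;> simp <;> noncomm_ring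
      rw [e]
      refine (norm_map_diagonal_le Φ _ _).trans (max_le (c1.trans m2) ?_)
      rw [norm_neg]; exact c2.trans m2
    have e : T * ((R + G) * F) - (R + G) * F * T =
        (T * R - R * T) * F + (T * (G * F) - G * F * T) := by
      have : R * F * T = R * T * F := by rw [mul_assoc, ← hTF, mul_assoc]
      rw [add_mul, add_mul, mul_add, this, sub_mul, ← mul_assoc T R F]
      abel
    rw [e]
    refine (norm_add_le _ _).trans ?_
    linarith [norm_mul_le (T * R - R * T) F,
      mul_le_of_le_one_right (norm_nonneg (T * R - R * T)) hF1]
end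

section
/- Let B and D be unital C*-algebras, let q : B → D be a surjective unital ⋆-homomorphism, and let (i_λ)_{λ∈Λ} be a quasicentral approximate unit for ker q. Let u ∈ D be a unitary, let a_1, …, a_N ∈ D satisfy [a_i, u] = 0 for all i, let A_1, …, A_N ∈ B satisfy q(A_i) = a_i, let X ∈ B be a contraction with q(X) = u, and let ε > 0. Then there exists λ ∈ Λ such that the element X̃ := X(1 − i_λ) satisfies q(X̃) = u, ‖X̃‖ ≤ 1, and for every i = 1, …, N: ‖[X̃, A_i]‖ ≤ ε/2, ‖[X̃*, A_i]‖ ≤ ε/2, ‖[X̃X̃*, A_i]‖ ≤ ε²/4, and ‖[X̃*X̃, A_i]‖ ≤ ε²/4. -/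
open Filter

/-- An element commuting with a unitary commutes with its adjoint. -/
theorem star_mul_eq_mul_star_of_mem_unitary {R : Type*} [Monoid R] [StarMul R] {u a : R}
    (hu : u ∈ unitary R) (ha : a * u = u * a) : star u * a = a * star u :=
  calc star u * a = star u * (a * u) * star u := by
        rw [mul_assoc, mul_assoc, Unitary.mul_star_self_of_mem hu, mul_one]
    _ = a * star u := by
        rw [ha, ← mul_assoc, Unitary.star_mul_self_of_mem hu, one_mul]

/-- The derivation property of the commutator bounds the commutator of a product of contractions
by the sum of the commutators. -/
theorem norm_mul_mul_sub_mul_mul_le {R : Type*} [NonUnitalNormedRing R] {s t : R}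
    (hs : ‖s‖ ≤ 1) (ht : ‖t‖ ≤ 1) (a : R) :
    ‖s * t * a - a * (s * t)‖ ≤ ‖s * a - a * s‖ + ‖t * a - a * t‖ :=
  calc ‖s * t * a - a * (s * t)‖ = ‖(s * a - a * s) * t + s * (t * a - a * t)‖ := by
        congr 1; noncomm_ring
    _ ≤ ‖s * a - a * s‖ * ‖t‖ + ‖s‖ * ‖t * a - a * t‖ :=
        norm_add_le_of_le (norm_mul_le _ _) (norm_mul_le _ _)
    _ ≤ ‖s * a - a * s‖ + ‖t * a - a * t‖ :=
        add_le_add (mul_le_of_le_one_right (norm_nonneg _) ht)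
          (mul_le_of_le_one_left (norm_nonneg _) hs)

/-- If `i` is asymptotically a right unit for `[x, a]` and asymptotically commutes with `a`, then
`x (1 - i)` asymptotically commutes with `a`. -/
theorem tendsto_norm_commutator_mul_one_sub {R Λ : Type*} [NormedRing R] {F : Filter Λ}
    {i : Λ → R} {x a : R}
    (hunit : Tendsto (fun l => ‖(x * a - a * x) * i l - (x * a - a * x)‖) F (nhds 0))
    (hcomm : Tendsto (fun l => ‖i l * a - a * i l‖) F (nhds 0)) :
    Tendsto (fun l => ‖x * (1 - i l) * a - a * (x * (1 - i l))‖) F (nhds 0) := by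
  refine squeeze_zero (fun _ => norm_nonneg _) (fun l => ?_)
    (by simpa using hunit.add (hcomm.const_mul ‖x‖))
  calc ‖x * (1 - i l) * a - a * (x * (1 - i l))‖
      = ‖((x * a - a * x) * i l - (x * a - a * x)) + x * (i l * a - a * i l)‖ := by
        rw [← norm_neg]; congr 1; noncomm_ring
    _ ≤ _ := norm_add_le_of_le le_rfl (norm_mul_le _ _)

/-- If `i` is asymptotically a left unit for `[x, a]` and asymptotically commutes with `a`, then
`(1 - i) x` asymptotically commutes with `a`. -/
theorem tendsto_norm_commutator_one_sub_mul {R Λ : Type*} [NormedRing R] {F : Filter Λ}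
    {i : Λ → R} {x a : R}
    (hunit : Tendsto (fun l => ‖i l * (x * a - a * x) - (x * a - a * x)‖) F (nhds 0))
    (hcomm : Tendsto (fun l => ‖i l * a - a * i l‖) F (nhds 0)) :
    Tendsto (fun l => ‖(1 - i l) * x * a - a * ((1 - i l) * x)‖) F (nhds 0) := by
  refine squeeze_zero (fun _ => norm_nonneg _) (fun l => ?_)
    (by simpa using hunit.add (hcomm.mul_const ‖x‖))
  calc ‖(1 - i l) * x * a - a * ((1 - i l) * x)‖
      = ‖(i l * (x * a - a * x) - (x * a - a * x)) + (i l * a - a * i l) * x‖ := by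
        rw [← norm_neg]; congr 1; noncomm_ring
    _ ≤ _ := norm_add_le_of_le le_rfl (norm_mul_le _ _)

/-- Let `q : B → D` be a surjective unital ⋆-homomorphism of unital C*-algebras and `(i_λ)` a
quasicentral approximate unit for `ker q`.  Let `u ∈ D` be a unitary commuting with
`a_1, …, a_N ∈ D`, let `A_1, …, A_N ∈ B` be lifts of the `a_i`, let `X ∈ B` be a contraction
lifting `u`, and let `ε > 0`.  Then there is `λ` such that `X̃ := X(1 - i_λ)` satisfies
`q(X̃) = u`, `‖X̃‖ ≤ 1`, and the four commutator estimates. -/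
theorem exists_good_lift_of_unitary
    {B D : Type*} [CStarAlgebra B] [PartialOrder B] [StarOrderedRing B] [CStarAlgebra D]
    {Λ : Type*} [Preorder Λ] [IsDirected Λ (· ≤ ·)] [Nonempty Λ]
    (q : B →⋆ₐ[ℂ] D) (hq : Function.Surjective q)
    (i : Λ → B)
    (h_mem : ∀ l, q (i l) = 0)
    (h_nonneg : ∀ l, 0 ≤ i l) (h_le_one : ∀ l, i l ≤ 1)
    (h_unit_left : ∀ x : B, q x = 0 → Tendsto (fun l => ‖i l * x - x‖) atTop (nhds 0))
    (h_unit_right : ∀ x : B, q x = 0 → Tendsto (fun l => ‖x * i l - x‖) atTop (nhds 0))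
    (h_quasicentral : ∀ b : B, Tendsto (fun l => ‖i l * b - b * i l‖) atTop (nhds 0))
    {N : ℕ} (u : D) (hu : u ∈ unitary D)
    (a : Fin N → D) (ha : ∀ j, a j * u = u * a j)
    (A : Fin N → B) (hA : ∀ j, q (A j) = a j)
    (X : B) (hX : ‖X‖ ≤ 1) (hXu : q X = u)
    (ε : ℝ) (hε : 0 < ε) :
    ∃ l : Λ,
      q (X * (1 - i l)) = u ∧
      ‖X * (1 - i l)‖ ≤ 1 ∧
      ∀ j : Fin N,
        ‖(X * (1 - i l)) * A j - A j * (X * (1 - i l))‖ ≤ ε / 2 ∧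
        ‖star (X * (1 - i l)) * A j - A j * star (X * (1 - i l))‖ ≤ ε / 2 ∧
        ‖(X * (1 - i l)) * star (X * (1 - i l)) * A j
            - A j * ((X * (1 - i l)) * star (X * (1 - i l)))‖ ≤ ε ^ 2 / 4 ∧
        ‖star (X * (1 - i l)) * (X * (1 - i l)) * A j
            - A j * (star (X * (1 - i l)) * (X * (1 - i l)))‖ ≤ ε ^ 2 / 4 := by
  have h_right (j : Fin N) := tendsto_norm_commutator_mul_one_sub
    (h_unit_right (X * A j - A j * X) (by simp [hXu, hA, ha])) (h_quasicentral (A j))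
  have h_left (j : Fin N) := tendsto_norm_commutator_one_sub_mul
    (h_unit_left (star X * A j - A j * star X)
      (by simp [hXu, hA, map_star, star_mul_eq_mul_star_of_mem_unitary hu (ha j)]))
    (h_quasicentral (A j))
  have hδ : 0 < min (ε / 2) (ε ^ 2 / 8) := by positivity
  obtain ⟨l, hl⟩ := (eventually_all.2 fun j =>
    ((h_right j).eventually_le_const hδ).and ((h_left j).eventually_le_const hδ)).exists
  have h_norm : ‖X * (1 - i l)‖ ≤ 1 :=
    (norm_mul_le _ _).trans <| mul_le_one₀ hX (norm_nonneg _) <|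
      (CStarAlgebra.norm_le_one_iff_of_nonneg _ (sub_nonneg.2 (h_le_one l))).2
        (sub_le_self 1 (h_nonneg l))
  have h_norm_star : ‖star (X * (1 - i l))‖ ≤ 1 := (norm_star _).trans_le h_norm
  have h_star : star (X * (1 - i l)) = (1 - i l) * star X := by
    rw [star_mul, star_sub, star_one, (IsSelfAdjoint.of_nonneg (h_nonneg l)).star_eq]
  refine ⟨l, by simp [h_mem, hXu], h_norm, fun j => ?_⟩
  obtain ⟨h₁, h₂⟩ := hl j
  rw [← h_star] at h₂
  have h₃ := norm_mul_mul_sub_mul_mul_le h_norm h_norm_star (A j)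
  have h₄ := norm_mul_mul_sub_mul_mul_le h_norm_star h_norm (A j)
  rw [le_min_iff] at h₁ h₂
  exact ⟨h₁.1, h₂.1, by linarith, by linarith⟩
end

section
/- Let F, G, H and N be groups, let φ_G : F → G and φ_H : F → H be injective group homomorphisms, let K = G ∗_F H be the corresponding amalgamated free product with canonical maps ι_G : G → K, ι_H : H → K, ι_F = ι_G ∘ φ_G : F → K, and let α : K → Aut(N) be an action of K on N by automorphisms. Then the semidirect product N ⋊_α K is isomorphic to the amalgamated free product (N ⋊ G) ∗_{N ⋊ F} (N ⋊ H), where G, H, F act on N via α ∘ ι_G, α ∘ ι_H, α ∘ ι_F respectively, and where the amalgamation homomorphisms N ⋊ F → N ⋊ G and N ⋊ F → N ⋊ H are induced by the identity on N and by φ_G, φ_H respectively. -/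
open SemidirectProduct

universe u

/-- A subgroup of a pushout of groups containing the images of both factors is everything. -/
theorem subgroup_eq_top_of_pushout {F G H K : Type u} [Group F] [Group G] [Group H] [Group K]
    {φG : F →* G} {φH : F →* H} {ιG : G →* K} {ιH : H →* K} (hι : ιG.comp φG = ιH.comp φH)
    (hK : ∀ (L : Type u) [Group L] (f : G →* L) (g : H →* L),
      f.comp φG = g.comp φH → ∃! h : K →* L, h.comp ιG = f ∧ h.comp ιH = g)
    (S : Subgroup K) (hG : ∀ g, ιG g ∈ S) (hH : ∀ h, ιH h ∈ S) : S = ⊤ := by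
  obtain ⟨r, ⟨hrG, hrH⟩, -⟩ := hK S (ιG.codRestrict S hG) (ιH.codRestrict S hH) <|
    MonoidHom.ext fun x => Subtype.ext (DFunLike.congr_fun hι x)
  have hr : S.subtype.comp r = MonoidHom.id K :=
    (hK K ιG ιH hι).unique
      ⟨by rw [MonoidHom.comp_assoc, hrG]; rfl, by rw [MonoidHom.comp_assoc, hrH]; rfl⟩ ⟨rfl, rfl⟩
  refine eq_top_iff.2 fun k _ => ?_
  have hk : (r k : K) = k := DFunLike.congr_fun hr k
  exact hk ▸ (r k).2

/-- The elements `k` for which conjugation by `c k` restricts along `a` to the action of `k`. -/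
def conjCompatible {N K L : Type*} [Group N] [Group K] [Group L]
    (α : K →* MulAut N) (a : N →* L) (c : K →* L) : Subgroup K where
  carrier := {k | ∀ n, a (α k n) = c k * a n * (c k)⁻¹}
  one_mem' n := by simp
  mul_mem' {x y} hx hy n := by
    rw [map_mul, MulAut.mul_apply, hx, hy, map_mul]
    group
  inv_mem' {x} hx n := by
    have h := hx (α x⁻¹ n)
    rw [← MulAut.mul_apply, ← map_mul, mul_inv_cancel, map_one, MulAut.one_apply] at h
    simp [h, mul_assoc]

/-- Let `K = G ∗_F H` be an amalgamated free product (expressed by its universal property as the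
pushout of injective homomorphisms `φG : F → G`, `φH : F → H`, with canonical maps `ιG, ιH`),
and let `α : K → Aut N` be an action on a group `N`.  Then `N ⋊[α] K` is the amalgamated free
product `(N ⋊ G) ∗_{N ⋊ F} (N ⋊ H)`: there are canonical maps `pG, pH` (identity on `N`, and
`φG, φH` on the group acting) and `κG, κH` (identity on `N`, and `ιG, ιH`) exhibiting
`N ⋊[α] K` as the pushout of `pG` and `pH` in the category of groups. -/
theorem semidirectProduct_amalgamated_pushout
    {F G H N K : Type u} [Group F] [Group G] [Group H] [Group N] [Group K]
    (φG : F →* G) (φH : F →* H)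
    (hφG : Function.Injective φG) (hφH : Function.Injective φH)
    (ιG : G →* K) (ιH : H →* K) (hι : ιG.comp φG = ιH.comp φH)
    (hK : ∀ (L : Type u) [Group L] (f : G →* L) (g : H →* L),
      f.comp φG = g.comp φH → ∃! h : K →* L, h.comp ιG = f ∧ h.comp ιH = g)
    (α : K →* MulAut N) :
    ∃ (pG : (N ⋊[(α.comp ιG).comp φG] F) →* N ⋊[α.comp ιG] G)
      (pH : (N ⋊[(α.comp ιG).comp φG] F) →* N ⋊[α.comp ιH] H)
      (κG : (N ⋊[α.comp ιG] G) →* N ⋊[α] K)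
      (κH : (N ⋊[α.comp ιH] H) →* N ⋊[α] K),
      (∀ n : N, pG (inl n) = inl n) ∧ (∀ f : F, pG (inr f) = inr (φG f)) ∧
      (∀ n : N, pH (inl n) = inl n) ∧ (∀ f : F, pH (inr f) = inr (φH f)) ∧
      (∀ n : N, κG (inl n) = inl n) ∧ (∀ g : G, κG (inr g) = inr (ιG g)) ∧
      (∀ n : N, κH (inl n) = inl n) ∧ (∀ h : H, κH (inr h) = inr (ιH h)) ∧
      κG.comp pG = κH.comp pH ∧
      ∀ (L : Type u) [Group L]
        (f : (N ⋊[α.comp ιG] G) →* L) (g : (N ⋊[α.comp ιH] H) →* L),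
        f.comp pG = g.comp pH →
        ∃! h : (N ⋊[α] K) →* L, h.comp κG = f ∧ h.comp κH = g := by
  have hactF (x : F) : α (ιH (φH x)) = α (ιG (φG x)) :=
    congrArg α (DFunLike.congr_fun hι x).symm
  let pG : (N ⋊[(α.comp ιG).comp φG] F) →* N ⋊[α.comp ιG] G :=
    SemidirectProduct.map (MonoidHom.id N) φG fun _ => rfl
  let pH : (N ⋊[(α.comp ιG).comp φG] F) →* N ⋊[α.comp ιH] H :=
    SemidirectProduct.map (MonoidHom.id N) φH fun x => by
      ext n
      simp [hactF]
  let κG : (N ⋊[α.comp ιG] G) →* N ⋊[α] K :=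
    SemidirectProduct.map (MonoidHom.id N) ιG fun _ => rfl
  let κH : (N ⋊[α.comp ιH] H) →* N ⋊[α] K :=
    SemidirectProduct.map (MonoidHom.id N) ιH fun _ => rfl
  have hpGl (n : N) : pG (inl n) = inl n := map_inl ..
  have hpGr (x : F) : pG (inr x) = inr (φG x) := map_inr ..
  have hpHl (n : N) : pH (inl n) = inl n := map_inl ..
  have hpHr (x : F) : pH (inr x) = inr (φH x) := map_inr ..
  have hκGl (n : N) : κG (inl n) = inl n := map_inl ..
  have hκGr (x : G) : κG (inr x) = inr (ιG x) := map_inr ..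
  have hκHl (n : N) : κH (inl n) = inl n := map_inl ..
  have hκHr (x : H) : κH (inr x) = inr (ιH x) := map_inr ..
  refine ⟨pG, pH, κG, κH, hpGl, hpGr, hpHl, hpHr, hκGl, hκGr, hκHl, hκHr, ?_, ?_⟩
  · refine SemidirectProduct.hom_ext (MonoidHom.ext fun n => ?_) (MonoidHom.ext fun x => ?_)
    · simp only [MonoidHom.comp_apply, hpGl, hpHl, hκGl, hκHl]
    · simp only [MonoidHom.comp_apply, hpGr, hpHr, hκGr, hκHr]
      exact congrArg inr (DFunLike.congr_fun hι x)
  · intro L _ f g hfg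
    have hfgl (n : N) : g (inl n) = f (inl n) := by
      simpa only [MonoidHom.comp_apply, hpGl, hpHl] using
        (DFunLike.congr_fun hfg (inl n)).symm
    have hfgr : (f.comp inr).comp φG = (g.comp inr).comp φH := MonoidHom.ext fun x => by
      simpa only [MonoidHom.comp_apply, hpGr, hpHr] using DFunLike.congr_fun hfg (inr x)
    obtain ⟨c, ⟨hcG, hcH⟩, hc⟩ := hK L (f.comp inr) (g.comp inr) hfgr
    have hcG' (x : G) : c (ιG x) = f (inr x) := DFunLike.congr_fun hcG x
    have hcH' (x : H) : c (ιH x) = g (inr x) := DFunLike.congr_fun hcH x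
    have htop : conjCompatible α (f.comp inl) c = ⊤ := by
      refine subgroup_eq_top_of_pushout hι hK _ (fun x n => ?_) (fun x n => ?_)
      · have h := congrArg f (inl_aut (φ := α.comp ιG) x n)
        simpa [hcG'] using h
      · have h := congrArg g (inl_aut (φ := α.comp ιH) x n)
        simpa [hcH', hfgl] using h
    have hconj (k : K) (n : N) : f (inl (α k n)) = c k * f (inl n) * (c k)⁻¹ :=
      (htop ▸ Subgroup.mem_top k : k ∈ conjCompatible α (f.comp inl) c) n
    refine ⟨SemidirectProduct.lift (f.comp inl) c fun k => MonoidHom.ext fun n => ?_,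
      ⟨?_, ?_⟩, ?_⟩
    · simpa using hconj k n
    · refine SemidirectProduct.hom_ext (MonoidHom.ext fun n => ?_) (MonoidHom.ext fun x => ?_)
      · simp [hκGl]
      · simp [hκGr, hcG']
    · refine SemidirectProduct.hom_ext (MonoidHom.ext fun n => ?_) (MonoidHom.ext fun x => ?_)
      · simp [hκHl, hfgl]
      · simp [hκHr, hcH']
    · rintro d ⟨rfl, rfl⟩
      refine SemidirectProduct.hom_ext (MonoidHom.ext fun n => ?_) ?_
      · simp [hκGl]
      · rw [lift_comp_inr]
        refine hc _ ⟨MonoidHom.ext fun x => ?_, MonoidHom.ext fun x => ?_⟩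
        · simp [hκGr]
        · simp [hκHr]
end

section
/- Let G be a group, let n be a positive integer, let F_n be the free group on generators t_1, …, t_n, and let α : F_n → Aut(G) be an action of F_n on G by automorphisms. For each i, let G ⋊ ℤ_i denote the semidirect product of G by ℤ where the generator of ℤ acts by α(t_i), and let θ_i : G → G ⋊ ℤ_i be the canonical inclusion. Then the semidirect product G ⋊_α F_n is isomorphic to the amalgamated free product of the n groups G ⋊ ℤ_1, …, G ⋊ ℤ_n amalgamated over G along the inclusions θ_1, …, θ_n (i.e., the pushout of the θ_i in the category of groups). -/
open SemidirectProduct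

universe u

/-- A homomorphism intertwining an action of a free group with conjugation on the generators
intertwines them on the whole free group. -/
theorem map_freeGroup_action_eq_conj {ι G L : Type*} [Group G] [Group L]
    (α : FreeGroup ι →* MulAut G) (k : G →* L) (τ : FreeGroup ι →* L)
    (h : ∀ i g, k (α (FreeGroup.of i) g) = τ (FreeGroup.of i) * k g * (τ (FreeGroup.of i))⁻¹)
    (w : FreeGroup ι) (g : G) : k (α w g) = τ w * k g * (τ w)⁻¹ := by
  induction w using FreeGroup.induction_on generalizing g with
  | C1 => simp
  | of i => exact h i g
  | inv_of i _ =>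
    have := h i (α (FreeGroup.of i)⁻¹ g)
    rw [← MulAut.mul_apply, ← map_mul, mul_inv_cancel, map_one, MulAut.one_apply] at this
    rw [this, map_inv τ]
    group
  | mul x y hx hy =>
    rw [map_mul, MulAut.mul_apply, hx, hy, map_mul]
    group

/-- Let `G` be a group with an action `α` of the free group `F_n` (on generators
`t_i = FreeGroup.of i`, `i : Fin n`, `n > 0`).  For each `i` let `G ⋊ ℤ_i` be the semidirect
product in which the generator of `ℤ` acts by `α(t_i)`, with canonical inclusion
`θ_i = inl : G → G ⋊ ℤ_i`.  Then `G ⋊[α] F_n` is the amalgamated free product of the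
`G ⋊ ℤ_i` over `G`: there are maps `j_i : G ⋊ ℤ_i → G ⋊ F_n` restricting to the identity on
`G` and sending the generator of `ℤ` to `t_i`, exhibiting `G ⋊[α] F_n` as the pushout of the
inclusions `θ_i` in the category of groups. -/
theorem semidirectProduct_freeGroup_pushout
    {G : Type u} [Group G] (n : ℕ) (hn : 0 < n)
    (α : FreeGroup (Fin n) →* MulAut G) :
    ∃ j : (i : Fin n) →
        (G ⋊[zpowersHom (MulAut G) (α (FreeGroup.of i))] Multiplicative ℤ) →*
          G ⋊[α] FreeGroup (Fin n),
      (∀ i (g : G), j i (inl g) = inl g) ∧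
      (∀ i, j i (inr (Multiplicative.ofAdd (1 : ℤ))) = inr (FreeGroup.of i)) ∧
      (∀ i k : Fin n, (j i).comp inl = (j k).comp inl) ∧
      ∀ (L : Type u) [Group L]
        (f : (i : Fin n) →
          (G ⋊[zpowersHom (MulAut G) (α (FreeGroup.of i))] Multiplicative ℤ) →* L),
        (∀ i k : Fin n, (f i).comp inl = (f k).comp inl) →
        ∃! h : (G ⋊[α] FreeGroup (Fin n)) →* L, ∀ i, h.comp (j i) = f i := by
  have hj (i : Fin n) (z : Multiplicative ℤ) :
      (MonoidHom.id G).comp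
          (zpowersHom (MulAut G) (α (FreeGroup.of i)) z).toMonoidHom =
        (α (zpowersHom _ (FreeGroup.of i) z)).toMonoidHom.comp (MonoidHom.id G) := by
    simp [zpowersHom_apply]
  refine ⟨fun i => SemidirectProduct.map (MonoidHom.id G) (zpowersHom _ (FreeGroup.of i)) (hj i),
    fun i g => by simp, fun i => by simp, fun i k => by simp, fun L _ f hf => ?_⟩
  let τ : FreeGroup (Fin n) →* L :=
    FreeGroup.lift fun i => f i (inr (Multiplicative.ofAdd (1 : ℤ)))
  have hk (i : Fin n) (g : G) : f ⟨0, hn⟩ (inl g) = f i (inl g) :=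
    DFunLike.congr_fun (hf ⟨0, hn⟩ i) g
  have hτ := map_freeGroup_action_eq_conj α ((f ⟨0, hn⟩).comp inl) τ fun i g => by
    have := inl_aut (φ := zpowersHom (MulAut G) (α (FreeGroup.of i)))
      (Multiplicative.ofAdd (1 : ℤ)) g
    rw [zpowersHom_apply, toAdd_ofAdd, zpow_one] at this
    rw [MonoidHom.comp_apply, MonoidHom.comp_apply, hk i, hk i, this, map_mul, map_mul, map_inv,
      map_inv, FreeGroup.lift_apply_of]
  refine ⟨SemidirectProduct.lift ((f ⟨0, hn⟩).comp inl) τ fun w => ?_, fun i => ?_,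
    fun h hh => ?_⟩
  · ext g
    simpa using hτ w g
  · refine SemidirectProduct.hom_ext ?_ ?_
    · ext g
      simp [hk i]
    · ext
      simp [τ]
  · refine SemidirectProduct.hom_ext ?_ ?_
    · ext g
      simp [← hh ⟨0, hn⟩]
    · ext i
      simp [τ, ← hh i]
end
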